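/- Let G be a finite group and H ≤ G a subgroup, and let H̃ = {(h,h,h) : h ∈ H} be the diagonal subgroup of G×G×H. Then the following are equivalent: (i) (G×G×H, H̃) is a Gelfand pair; (ii) for all irreducible complex representations ρ₁, ρ₂ of G, the restriction Res^G_H(ρ₁⊗ρ₂) of the inner tensor product ρ₁⊗ρ₂ to H is multiplicity-free. -/

import Mathlib

/-- `(G, K)` is a Gelfand pair if the convolution algebra of bi-`K`-invariant functions
`f : G → ℂ` is commutative. -/
def IsGelfandPair (G : Type*) [Group G] [Fintype G] (K : Subgroup G) : Prop :=
  ∀ f₁ f₂ : G → ℂ,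
    (∀ (k₁ k₂ : K) (g : G), f₁ (↑k₁ * g * ↑k₂) = f₁ g) →
    (∀ (k₁ k₂ : K) (g : G), f₂ (↑k₁ * g * ↑k₂) = f₂ g) →
    ∀ g : G, ∑ x : G, f₁ x * f₂ (x⁻¹ * g) = ∑ x : G, f₂ x * f₁ (x⁻¹ * g)

/-- The diagonal subgroup `H̃ = {(h,h,h) : h ∈ H}` of `G × G × H`. -/
def diag3 (G : Type*) [Group G] (H : Subgroup G) : Subgroup (G × G × H) where
  carrier := {x | ∃ h : H, x = ((h : G), (h : G), h)}
  mul_mem' := by rintro _ _ ⟨h₁, rfl⟩ ⟨h₂, rfl⟩; exact ⟨h₁ * h₂, rfl⟩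
  one_mem' := ⟨1, rfl⟩
  inv_mem' := by rintro _ ⟨h, rfl⟩; exact ⟨h⁻¹, rfl⟩

open scoped TensorProduct

noncomputable instance Representation.asModuleAddCommGroup {G V : Type*} [Group G]
    [AddCommGroup V] [Module ℂ V] (ρ : Representation ℂ G V) : AddCommGroup ρ.asModule :=
  inferInstanceAs (AddCommGroup V)

/-- A representation is irreducible (simple) if the corresponding module over the group
algebra `ℂ[G]` is a simple module. -/
def IsIrreducibleRep {G V : Type*} [Group G] [AddCommGroup V] [Module ℂ V]
    (ρ : Representation ℂ G V) : Prop :=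
  IsSimpleModule (MonoidAlgebra ℂ G) ρ.asModule

/-- A representation is multiplicity-free if it decomposes as a direct sum of pairwise
inequivalent irreducible subrepresentations, i.e. the corresponding `ℂ[G]`-module is an
internal direct sum of simple submodules that are pairwise non-isomorphic. -/
def IsMultiplicityFree {G V : Type*} [Group G] [AddCommGroup V] [Module ℂ V]
    (ρ : Representation ℂ G V) : Prop :=
  ∃ (ι : Type) (_ : Fintype ι) (_ : DecidableEq ι)
    (Ws : ι → Submodule (MonoidAlgebra ℂ G) ρ.asModule),
    DirectSum.IsInternal Ws ∧ (∀ i, IsSimpleModule (MonoidAlgebra ℂ G) (Ws i)) ∧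
      ∀ i j, i ≠ j → IsEmpty ((Ws i) ≃ₗ[MonoidAlgebra ℂ G] (Ws j))

section Module

variable {R M : Type*} [Ring R] [Algebra ℂ R] [AddCommGroup M] [Module ℂ M] [Module R M]
  [IsScalarTower ℂ R M] [FiniteDimensional ℂ M]

/-- Endomorphisms of a direct sum of pairwise non-isomorphic simple modules commute. -/
theorem DirectSum.IsInternal.commute_end {ι : Type*} [DecidableEq ι] {W : ι → Submodule R M}
    (hW : DirectSum.IsInternal W) (hs : ∀ i, IsSimpleModule R (W i))
    (hne : ∀ i j, i ≠ j → IsEmpty (W i ≃ₗ[R] W j)) (f g : Module.End R M) : Commute f g := by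
  let e : DirectSum ι (fun i ↦ W i) ≃ₗ[R] M := LinearEquiv.ofBijective (DirectSum.coeLinearMap W) hW
  have scalar (f : Module.End R M) (i : ι) : ∃ c : ℂ, ∀ w : W i, f w = c • (w : M) := by
    let q (j : ι) : W i →ₗ[R] W j :=
      DirectSum.component R ι (fun i ↦ W i) j ∘ₗ e.symm.toLinearMap ∘ₗ f ∘ₗ (W i).subtype
    have hfd : FiniteDimensional ℂ (W i) :=
      Module.Finite.of_injective ((W i).subtype.restrictScalars ℂ) Subtype.val_injective
    have hq (j : ι) (hj : j ≠ i) : q j = 0 := by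
      refine (LinearMap.bijective_or_eq_zero (q j)).resolve_left fun hb ↦ ?_
      exact (hne i j hj.symm).false (LinearEquiv.ofBijective _ hb)
    obtain ⟨c, hc⟩ :=
      (IsSimpleModule.algebraMap_end_bijective_of_isAlgClosed (A := R) (V := W i) ℂ).2 (q i)
    refine ⟨c, fun w ↦ ?_⟩
    have hw : e.symm (f w) = DirectSum.of (fun i ↦ W i) i (c • w) := by
      refine DFinsupp.ext fun j ↦ ?_
      by_cases hj : j = i
      · subst hj
        rw [DirectSum.of_eq_same]
        exact (LinearMap.congr_fun hc w).symm
      · rw [DirectSum.of_eq_of_ne _ _ _ hj]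
        exact LinearMap.congr_fun (hq j hj) w
    rw [LinearEquiv.symm_apply_eq] at hw
    rw [hw]
    exact DirectSum.coeAddMonoidHom_of W i (c • w)
  have hsup : ⨆ i, W i = ⊤ := hW.submodule_iSup_eq_top
  refine LinearMap.ext fun x ↦ ?_
  refine Submodule.iSup_induction W (motive := fun x ↦ (f * g) x = (g * f) x)
    (hsup ▸ Submodule.mem_top : x ∈ _) (fun i w hw ↦ ?_) (by simp) fun x y hx hy ↦ ?_
  · obtain ⟨c, hc⟩ := scalar f i
    obtain ⟨d, hd⟩ := scalar g i
    have hf := hc ⟨w, hw⟩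
    have hg := hd ⟨w, hw⟩
    have key (h : Module.End R M) (a : ℂ) : h (a • w) = a • h w :=
      (h.restrictScalars ℂ).map_smul a w
    simp only [Module.End.mul_apply] at *
    rw [hf, hg, key, key, hf, hg, smul_comm]
  · rw [map_add, map_add, hx, hy]

/-- A semisimple module whose endomorphisms commute is a direct sum of pairwise non-isomorphic
simple submodules. -/
theorem exists_isInternal_of_commute_end [IsSemisimpleModule R M]
    (hcomm : ∀ f g : Module.End R M, Commute f g) :
    ∃ s : Set (Submodule R M), s.Finite ∧ DirectSum.IsInternal (fun i : s ↦ (i : Submodule R M)) ∧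
      (∀ i : s, IsSimpleModule R i) ∧
        ∀ i j : s, i ≠ j → IsEmpty ((i : Submodule R M) ≃ₗ[R] (j : Submodule R M)) := by
  obtain ⟨s, hind, hsup, hs⟩ := IsSemisimpleModule.exists_sSupIndep_sSup_simples_eq_top R M
  have hnoeth : IsNoetherian R M := isNoetherian_of_tower ℂ inferInstance
  refine ⟨s, WellFoundedGT.finite_of_sSupIndep hind, ?_, fun i ↦ hs i i.2,
    fun i j hij ↦ ⟨fun φ ↦ ?_⟩⟩
  · exact DirectSum.isInternal_submodule_of_iSupIndep_of_iSup_eq_top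
      ((sSupIndep_iff _).1 hind) (by rw [← sSup_eq_iSup', hsup])
  · obtain ⟨C, hC⟩ := exists_isCompl (i : Submodule R M)
    have hdisj : Disjoint (i : Submodule R M) j :=
      hind.pairwiseDisjoint i.2 j.2 (Subtype.coe_injective.ne hij)
    let p : Module.End R M := (i : Submodule R M).projection C hC
    let t : Module.End R M := (j : Submodule R M).subtype ∘ₗ φ.toLinearMap ∘ₗ
      (i : Submodule R M).projectionOnto C hC
    have := (hs i i.2).nontrivial
    obtain ⟨w, hw⟩ := exists_ne (0 : (i : Submodule R M))
    have h1 : (p * t) w = (t * p) w := LinearMap.congr_fun (hcomm p t) w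
    have h2 : (t * p) w = φ w := by simp [t, p]
    have h3 : (p * t) w ∈ (i : Submodule R M) := by simp [p]
    rw [h1, h2] at h3
    have h4 := Submodule.disjoint_def.1 hdisj _ h3 (φ w).2
    exact hw (by simpa using h4)

end Module

section Convolution

variable {P L W : Type*} [Group P] [Fintype P] [Group L] [AddCommGroup W] [Module ℂ W]

/-- Convolution of complex functions on a finite group. -/
noncomputable def groupConv (φ ψ : P → ℂ) (p : P) : ℂ := ∑ q, φ q * ψ (q⁻¹ * p)

/-- The operator by which a function on a finite group acts on a representation. -/
noncomputable def Representation.functionAction (σ : Representation ℂ P W) (φ : P → ℂ) :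
    Module.End ℂ W := ∑ q, φ q • σ q

/-- Functions on `P` which are invariant under conjugation through `ι : L →* P`. -/
def IsConjInvariant (ι : L →* P) (φ : P → ℂ) : Prop :=
  ∀ (l : L) (p : P), φ (ι l * p * (ι l)⁻¹) = φ p

theorem Representation.functionAction_sub (σ : Representation ℂ P W) (φ ψ : P → ℂ) :
    σ.functionAction (φ - ψ) = σ.functionAction φ - σ.functionAction ψ := by
  simp [functionAction, sub_smul]

theorem Representation.functionAction_groupConv (σ : Representation ℂ P W) (φ ψ : P → ℂ) :
    σ.functionAction (groupConv φ ψ) = σ.functionAction φ * σ.functionAction ψ := by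
  simp only [functionAction, groupConv, Finset.sum_smul, Finset.sum_mul_sum]
  rw [Finset.sum_comm]
  refine Finset.sum_congr rfl fun q _ ↦ ?_
  refine Fintype.sum_equiv (Equiv.mulLeft q⁻¹) _ _ fun p ↦ ?_
  simp [smul_smul, mul_comm, ← map_mul]

theorem IsConjInvariant.commute_functionAction {ι : L →* P} {φ : P → ℂ} (hφ : IsConjInvariant ι φ)
    (σ : Representation ℂ P W) (l : L) : Commute (σ.functionAction φ) (σ (ι l)) := by
  simp only [Commute, SemiconjBy, Representation.functionAction, Finset.sum_mul, Finset.mul_sum]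
  refine Fintype.sum_equiv (MulAut.conj (ι l)⁻¹).toEquiv _ _ fun p ↦ ?_
  have h := hφ l⁻¹ p
  simp only [map_inv, inv_inv] at h
  simp [← map_mul, mul_assoc] at h ⊢
  rw [h]

/-- If every operator comes from a function on `P`, then the operators commuting with `L` come,
up to a nonzero scalar, from functions invariant under conjugation by `L`. -/
theorem exists_isConjInvariant_functionAction_eq [Fintype L] (ι : L →* P)
    (σ : Representation ℂ P W) (hσ : ∀ T : Module.End ℂ W, ∃ φ, T = σ.functionAction φ)
    (T : Module.End ℂ W) (hT : ∀ l, Commute T (σ (ι l))) :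
    ∃ φ, IsConjInvariant ι φ ∧ (Fintype.card L : ℂ) • T = σ.functionAction φ := by
  obtain ⟨φ, hφ⟩ := hσ T
  refine ⟨fun p ↦ ∑ l, φ (ι l * p * (ι l)⁻¹), fun k p ↦ ?_, ?_⟩
  · refine Fintype.sum_equiv (Equiv.mulRight k) _ _ fun l ↦ ?_
    simp [mul_assoc]
  · have key (l : L) : ∑ p, φ (ι l * p * (ι l)⁻¹) • σ p = T := by
      have h : T = σ (ι l)⁻¹ * T * σ (ι l) := by
        rw [mul_assoc, (hT l).eq, ← mul_assoc, ← map_mul]; simp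
      rw [h, hφ, Representation.functionAction, Finset.mul_sum, Finset.sum_mul]
      refine Fintype.sum_equiv (MulAut.conj (ι l)).toEquiv _ _ fun p ↦ ?_
      simp [← map_mul, mul_assoc]
    simp only [Representation.functionAction, Finset.sum_smul]
    rw [Finset.sum_comm]
    simp [key, Nat.cast_smul_eq_nsmul]

/-- If the functions on `P` invariant under conjugation by `L` commute and the functions on `P`
yield all operators on `W`, then the operators on `W` commuting with `L` commute. -/
theorem commute_of_groupConv_comm [Fintype L] (ι : L →* P)
    (hconv : ∀ φ ψ : P → ℂ, IsConjInvariant ι φ → IsConjInvariant ι ψ →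
      groupConv φ ψ = groupConv ψ φ)
    (σ : Representation ℂ P W) (hσ : ∀ T : Module.End ℂ W, ∃ φ, T = σ.functionAction φ)
    (S T : Module.End ℂ W) (hS : ∀ l, Commute S (σ (ι l))) (hT : ∀ l, Commute T (σ (ι l))) :
    Commute S T := by
  obtain ⟨φ, hφ, hSφ⟩ := exists_isConjInvariant_functionAction_eq ι σ hσ S hS
  obtain ⟨ψ, hψ, hTψ⟩ := exists_isConjInvariant_functionAction_eq ι σ hσ T hT
  have hc : (Fintype.card L : ℂ) ≠ 0 := by simp
  have : Commute ((Fintype.card L : ℂ) • S) ((Fintype.card L : ℂ) • T) := by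
    rw [hSφ, hTψ, Commute, SemiconjBy, ← σ.functionAction_groupConv, hconv φ ψ hφ hψ,
      σ.functionAction_groupConv]
  simpa [Commute.smul_left_iff₀ hc, Commute.smul_right_iff₀ hc] using this

end Convolution

section Representation

variable {G V : Type*} [Group G] [AddCommGroup V] [Module ℂ V] [FiniteDimensional ℂ V]

/-- Burnside's theorem on matrix algebras for irreducible representations. -/
theorem IsIrreducibleRep.exists_functionAction_eq [Fintype G] {ρ : Representation ℂ G V}
    (hρ : IsIrreducibleRep ρ) (T : Module.End ℂ V) : ∃ φ, T = ρ.functionAction φ := by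
  have : IsSimpleModule (MonoidAlgebra ℂ G) ρ.asModule := hρ
  have hsc := (IsSimpleModule.algebraMap_end_bijective_of_isAlgClosed
    (A := MonoidAlgebra ℂ G) (V := ρ.asModule) ℂ).2
  let f : Module.End (Module.End (MonoidAlgebra ℂ G) ρ.asModule) ρ.asModule :=
    { toFun := fun v ↦ T v
      map_add' := fun x y ↦ T.map_add x y
      map_smul' := fun c x ↦ by
        obtain ⟨c, rfl⟩ := hsc c
        exact T.map_smul c x }
  obtain ⟨s, hs⟩ := Module.Finite.fg_top (R := ℂ) (M := V)
  obtain ⟨r, hr⟩ := jacobson_density f s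
  refine ⟨r.coeff, LinearMap.ext_on hs fun v hv ↦ ?_⟩
  have h1 : T v = ρ.asAlgebraHom r v := hr v hv
  rw [h1]
  congr 1
  rw [Representation.asAlgebraHom_def, MonoidAlgebra.lift_apply, Representation.functionAction,
    Finsupp.sum_fintype _ _ (by simp)]

theorem isMultiplicityFree_iff_commute {G V : Type} [Group G] [Fintype G] [AddCommGroup V]
    [Module ℂ V] [FiniteDimensional ℂ V] (τ : Representation ℂ G V) :
    IsMultiplicityFree τ ↔ ∀ S T : Module.End ℂ V, (∀ g, Commute S (τ g)) →
      (∀ g, Commute T (τ g)) → Commute S T := by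
  have : NeZero (Nat.card G : ℂ) := ⟨by simp⟩
  let e := Representation.IntertwiningMap.equivAlgEnd (ρ := τ)
  constructor
  · rintro ⟨ι, _, _, W, hW, hs, hne⟩ S T hS hT
    have h := (hW.commute_end hs hne (e ⟨S, hS⟩) (e ⟨T, hT⟩)).map e.symm
    rw [e.symm_apply_apply, e.symm_apply_apply] at h
    exact congrArg Representation.IntertwiningMap.toLinearMap h.eq
  · intro h
    obtain ⟨s, hfin, hs⟩ := exists_isInternal_of_commute_end (R := MonoidAlgebra ℂ G)
      (M := τ.asModule) fun f g ↦ by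
        have hc : Commute (e.symm f) (e.symm g) :=
          Representation.IntertwiningMap.ext
            (h _ _ (e.symm f).isIntertwining' (e.symm g).isIntertwining')
        simpa using hc.map e
    classical exact ⟨s, hfin.fintype, inferInstance, _, hs⟩

/-- The external tensor product of two representations of `G`, a representation of `G × G`. -/
noncomputable def Representation.externalTprod {V₁ V₂ : Type*} [AddCommGroup V₁] [Module ℂ V₁]
    [AddCommGroup V₂] [Module ℂ V₂] (ρ₁ : Representation ℂ G V₁) (ρ₂ : Representation ℂ G V₂) :
    Representation ℂ (G × G) (V₁ ⊗[ℂ] V₂) :=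
  Representation.tprod (ρ₁.comp (MonoidHom.fst G G)) (ρ₂.comp (MonoidHom.snd G G))

theorem Representation.externalTprod_apply {V₁ V₂ : Type*} [AddCommGroup V₁] [Module ℂ V₁]
    [AddCommGroup V₂] [Module ℂ V₂] (ρ₁ : Representation ℂ G V₁) (ρ₂ : Representation ℂ G V₂)
    (g : G × G) : ρ₁.externalTprod ρ₂ g = TensorProduct.map (ρ₁ g.1) (ρ₂ g.2) := rfl

theorem IsIrreducibleRep.exists_externalTprod_functionAction_eq [Fintype G] {V₁ V₂ : Type*}
    [AddCommGroup V₁] [Module ℂ V₁] [FiniteDimensional ℂ V₁]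
    [AddCommGroup V₂] [Module ℂ V₂] [FiniteDimensional ℂ V₂]
    {ρ₁ : Representation ℂ G V₁} {ρ₂ : Representation ℂ G V₂}
    (h₁ : IsIrreducibleRep ρ₁) (h₂ : IsIrreducibleRep ρ₂) (T : Module.End ℂ (V₁ ⊗[ℂ] V₂)) :
    ∃ φ, T = (ρ₁.externalTprod ρ₂).functionAction φ := by
  obtain ⟨x, rfl⟩ := (homTensorHomEquiv ℂ V₁ V₂ V₁ V₂).surjective T
  induction x with
  | zero => exact ⟨0, by simp [Representation.functionAction]⟩
  | add x y hx hy =>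
    obtain ⟨φ, hφ⟩ := hx
    obtain ⟨ψ, hψ⟩ := hy
    refine ⟨φ + ψ, ?_⟩
    rw [map_add, hφ, hψ]
    simp [Representation.functionAction, add_smul, Finset.sum_add_distrib]
  | tmul A B =>
    obtain ⟨φ, rfl⟩ := h₁.exists_functionAction_eq A
    obtain ⟨ψ, rfl⟩ := h₂.exists_functionAction_eq B
    refine ⟨fun g ↦ φ g.1 * ψ g.2, ?_⟩
    refine TensorProduct.ext' fun v w ↦ ?_
    simp [Representation.functionAction, Fintype.sum_prod_type, TensorProduct.sum_tmul,
      TensorProduct.tmul_sum, Finset.smul_sum, ← TensorProduct.smul_tmul', smul_smul,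
      Representation.externalTprod_apply]
    rw [Finset.sum_comm]
    simp [mul_comm]

theorem isIrreducibleRep_ofModule' {M : Type*} [AddCommGroup M] [Module ℂ M]
    [Module (MonoidAlgebra ℂ G) M] [IsScalarTower ℂ (MonoidAlgebra ℂ G) M]
    [IsSimpleModule (MonoidAlgebra ℂ G) M] :
    IsIrreducibleRep (Representation.ofModule' (k := ℂ) (G := G) M) := by
  let e : (Representation.ofModule' (k := ℂ) (G := G) M).asModule ≃ₗ[MonoidAlgebra ℂ G] M :=
    { toFun := fun x ↦ x
      invFun := fun x ↦ x
      left_inv := fun _ ↦ rfl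
      right_inv := fun _ ↦ rfl
      map_add' := fun _ _ ↦ rfl
      map_smul' := fun r x ↦ by
        have : (Representation.ofModule' (k := ℂ) (G := G) M).asAlgebraHom r =
            Algebra.lsmul ℂ ℂ M r := by
          rw [Representation.asAlgebraHom_def, Representation.ofModule', Equiv.apply_symm_apply]
        exact LinearMap.congr_fun this x }
  exact IsSimpleModule.congr e

/-- A function on `G × G` acting by zero on all external tensor products of irreducible
representations vanishes. -/
theorem eq_zero_of_forall_externalTprod_functionAction_eq_zero {G : Type} [Group G] [Fintype G]
    (c : G × G → ℂ)
    (hc : ∀ (V₁ V₂ : Type) [AddCommGroup V₁] [Module ℂ V₁] [FiniteDimensional ℂ V₁]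
      [AddCommGroup V₂] [Module ℂ V₂] [FiniteDimensional ℂ V₂]
      (ρ₁ : Representation ℂ G V₁) (ρ₂ : Representation ℂ G V₂),
      IsIrreducibleRep ρ₁ → IsIrreducibleRep ρ₂ → (ρ₁.externalTprod ρ₂).functionAction c = 0) :
    c = 0 := by
  have : NeZero (Nat.card G : ℂ) := ⟨by simp⟩
  let A := MonoidAlgebra ℂ G
  have hfin : FiniteDimensional ℂ A :=
    Module.Finite.equiv (MonoidAlgebra.coeffLinearEquiv ℂ).symm
  let B (x y : A) : A ⊗[ℂ] A :=
    ∑ g : G × G, c g • ((MonoidAlgebra.single g.1 1 * x) ⊗ₜ (MonoidAlgebra.single g.2 1 * y))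
  have hB (x y : A) : B x y = 0 := by
    have hmem (x : A) :
        x ∈ ⨆ S : {S : Submodule A A | IsSimpleModule A S}, (S : Submodule A A) := by
      rw [← sSup_eq_iSup', IsSemisimpleModule.sSup_simples_eq_top]
      trivial
    refine Submodule.iSup_induction _ (motive := fun x ↦ B x y = 0) (hmem x) (fun S₁ x hx ↦ ?_)
      (by simp [B]) fun x x' hx hx' ↦ ?_
    · refine Submodule.iSup_induction _ (motive := fun y ↦ B x y = 0) (hmem y) (fun S₂ y hy ↦ ?_)
        (by simp [B]) fun y y' hy hy' ↦ ?_
      · have hs₁ : IsSimpleModule (MonoidAlgebra ℂ G) (S₁ : Submodule A A) := S₁.2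
        have hs₂ : IsSimpleModule (MonoidAlgebra ℂ G) (S₂ : Submodule A A) := S₂.2
        have h₁ : FiniteDimensional ℂ (S₁ : Submodule A A) := Module.Finite.of_injective
          ((S₁ : Submodule A A).subtype.restrictScalars ℂ) Subtype.val_injective
        have h₂ : FiniteDimensional ℂ (S₂ : Submodule A A) := Module.Finite.of_injective
          ((S₂ : Submodule A A).subtype.restrictScalars ℂ) Subtype.val_injective
        have h := hc (S₁ : Submodule A A) (S₂ : Submodule A A) _ _
          (isIrreducibleRep_ofModule' (G := G)) (isIrreducibleRep_ofModule' (G := G))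
        have h' := congrArg (TensorProduct.map ((S₁ : Submodule A A).subtype.restrictScalars ℂ)
          ((S₂ : Submodule A A).subtype.restrictScalars ℂ))
          (LinearMap.congr_fun h (⟨x, hx⟩ ⊗ₜ ⟨y, hy⟩))
        simpa [Representation.functionAction, Representation.externalTprod_apply,
          Representation.ofModule', B] using h'
      · simp only [B, mul_add, TensorProduct.tmul_add, smul_add, Finset.sum_add_distrib] at *
        rw [hy, hy', add_zero]
    · simp only [B, mul_add, TensorProduct.add_tmul, smul_add, Finset.sum_add_distrib] at *
      rw [hx, hx', add_zero]
  classical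
  funext g
  let p (a : G) : A →ₗ[ℂ] ℂ := Finsupp.lapply a ∘ₗ (MonoidAlgebra.coeffLinearEquiv ℂ).toLinearMap
  have hp (a b : G) : p a (MonoidAlgebra.single b 1) = if b = a then 1 else 0 :=
    Finsupp.single_apply
  have h := congrArg (LinearMap.mul' ℂ ℂ ∘ₗ TensorProduct.map (p g.1) (p g.2)) (hB 1 1)
  simpa [B, hp, Fintype.sum_prod_type] using h

end Representation

section Gelfand

variable {G : Type*} [Group G] [Fintype G] (H : Subgroup G) [Fintype H]

/-- The diagonal embedding of `H` into `G × G`. -/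
def diagEmbedding : H →* G × G := H.subtype.prod H.subtype

theorem isGelfandPair_diag3_iff : IsGelfandPair (G × G × H) (diag3 G H) ↔
    ∀ φ ψ : G × G → ℂ, IsConjInvariant (diagEmbedding H) φ →
      IsConjInvariant (diagEmbedding H) ψ → groupConv φ ψ = groupConv ψ φ := by
  have conv (f₁ f₂ : G × G × H → ℂ)
      (h₁ : ∀ (k₁ k₂ : diag3 G H) (g : G × G × H), f₁ (↑k₁ * g * ↑k₂) = f₁ g)
      (h₂ : ∀ (k₁ k₂ : diag3 G H) (g : G × G × H), f₂ (↑k₁ * g * ↑k₂) = f₂ g) (g : G × G × H) :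
      ∑ x, f₁ x * f₂ (x⁻¹ * g) = Fintype.card H * groupConv (fun p ↦ f₁ (p.1, p.2, 1))
        (fun p ↦ f₂ (p.1, p.2, 1)) (g.1 * (g.2.2 : G)⁻¹, g.2.1 * (g.2.2 : G)⁻¹) := by
    have shift (f : G × G × H → ℂ)
        (hf : ∀ (k₁ k₂ : diag3 G H) (g : G × G × H), f (↑k₁ * g * ↑k₂) = f g) (a b : G) (h : H) :
        f (a, b, h) = f (a * (h : G)⁻¹, b * (h : G)⁻¹, 1) := by
      simpa using (hf 1 ⟨((h⁻¹ : H), (h⁻¹ : H), h⁻¹), h⁻¹, rfl⟩ (a, b, h)).symm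
    let E : (G × G) × H ≃ G × G × H :=
      { toFun := fun x ↦ (x.1.1 * x.2, x.1.2 * x.2, x.2)
        invFun := fun x ↦ ((x.1 * (x.2.2 : G)⁻¹, x.2.1 * (x.2.2 : G)⁻¹), x.2.2)
        left_inv := fun x ↦ by simp
        right_inv := fun x ↦ by simp }
    rw [← E.sum_comp, Fintype.sum_prod_type, groupConv, Finset.mul_sum]
    refine Finset.sum_congr rfl fun p _ ↦ ?_
    rw [← nsmul_eq_mul, ← Finset.card_univ, ← Finset.sum_const]
    refine Finset.sum_congr rfl fun h _ ↦ ?_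
    obtain ⟨x, y, z⟩ := g
    have e₁ : f₁ (E (p, h)) = f₁ (p.1, p.2, 1) := by
      rw [shift f₁ h₁]
      simp [E]
    have e₂ : f₂ ((E (p, h))⁻¹ * (x, y, z)) = f₂ (p.1⁻¹ * x, p.2⁻¹ * y, z) := by
      rw [← h₂ ⟨((h : G), (h : G), h), h, rfl⟩ 1]
      simp [E, mul_assoc]
    rw [e₁, e₂, shift f₂ h₂]
    simp [mul_assoc]
  constructor
  · intro hG φ ψ hφ hψ
    let F (φ : G × G → ℂ) (g : G × G × H) : ℂ :=
      φ (g.1 * (g.2.2 : G)⁻¹, g.2.1 * (g.2.2 : G)⁻¹)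
    have hF (φ : G × G → ℂ) (hφ : IsConjInvariant (diagEmbedding H) φ) (k₁ k₂ : diag3 G H)
        (g : G × G × H) : F φ (↑k₁ * g * ↑k₂) = F φ g := by
      obtain ⟨_, a, rfl⟩ := k₁
      obtain ⟨_, b, rfl⟩ := k₂
      refine Eq.trans ?_ (hφ a _)
      simp [F, diagEmbedding, mul_assoc]
    funext p
    have h := hG (F φ) (F ψ) (hF φ hφ) (hF ψ hψ) (p.1, p.2, 1)
    rw [conv _ _ (hF φ hφ) (hF ψ hψ), conv _ _ (hF ψ hψ) (hF φ hφ)] at h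
    simpa [F] using h
  · intro hc f₁ f₂ h₁ h₂ g
    have descend (f : G × G × H → ℂ)
        (hf : ∀ (k₁ k₂ : diag3 G H) (g : G × G × H), f (↑k₁ * g * ↑k₂) = f g) :
        IsConjInvariant (diagEmbedding H) fun p ↦ f (p.1, p.2, 1) := fun l p ↦ by
      simpa [diagEmbedding] using hf ⟨((l : G), (l : G), l), l, rfl⟩
        ⟨((l⁻¹ : H), (l⁻¹ : H), l⁻¹), l⁻¹, rfl⟩ (p.1, p.2, 1)
    rw [conv f₁ f₂ h₁ h₂, conv f₂ f₁ h₂ h₁, hc _ _ (descend f₁ h₁) (descend f₂ h₂)]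

end Gelfand

/-- Mackey-type criterion (Theorem 1.1): `(G×G×H, H̃)` is a Gelfand pair if and only if
`Res^G_H(ρ₁ ⊗ ρ₂)` is multiplicity-free for all irreducible representations `ρ₁, ρ₂` of `G`. -/
theorem stmt0 (G : Type) [Group G] [Fintype G] (H : Subgroup G) [Fintype H] :
    IsGelfandPair (G × G × H) (diag3 G H) ↔
      ∀ (V₁ V₂ : Type) [AddCommGroup V₁] [Module ℂ V₁] [FiniteDimensional ℂ V₁]
        [AddCommGroup V₂] [Module ℂ V₂] [FiniteDimensional ℂ V₂]
        (ρ₁ : Representation ℂ G V₁) (ρ₂ : Representation ℂ G V₂),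
        IsIrreducibleRep ρ₁ → IsIrreducibleRep ρ₂ →
          IsMultiplicityFree (MonoidHom.comp (ρ₁.tprod ρ₂) H.subtype) := by
  rw [isGelfandPair_diag3_iff]
  constructor
  · intro hc V₁ V₂ _ _ _ _ _ _ ρ₁ ρ₂ hρ₁ hρ₂
    rw [isMultiplicityFree_iff_commute]
    exact commute_of_groupConv_comm (diagEmbedding H) hc (ρ₁.externalTprod ρ₂)
      (hρ₁.exists_externalTprod_functionAction_eq hρ₂)
  · intro hmf φ ψ hφ hψ
    rw [← sub_eq_zero]
    refine eq_zero_of_forall_externalTprod_functionAction_eq_zero _ ?_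
    intro V₁ V₂ _ _ _ _ _ _ ρ₁ ρ₂ hρ₁ hρ₂
    let σ := ρ₁.externalTprod ρ₂
    have h : Commute (σ.functionAction φ) (σ.functionAction ψ) :=
      (isMultiplicityFree_iff_commute _).1 (hmf V₁ V₂ ρ₁ ρ₂ hρ₁ hρ₂) _ _
        (hφ.commute_functionAction σ) (hψ.commute_functionAction σ)
    rw [σ.functionAction_sub, σ.functionAction_groupConv, σ.functionAction_groupConv, h.eq,
      sub_self]
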